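/- Let C = v_0 v_1 … v_{t−1} v_0 be a non-extendable cycle in a graph G, and suppose v_i and v_j are distinct vertices of C both adjacent to a common off-cycle vertex x. Then neither v_{i+1}v_{j+1} nor v_{i−1}v_{j−1} is an edge of G (indices mod t). -/

import Mathlib

/-- `v : ZMod t → V` lists the vertices of a cycle of length `t ≥ 3` in `G`. -/
def IsCycleFun {V : Type*} (G : SimpleGraph V) (t : ℕ) (v : ZMod t → V) : Prop :=
  3 ≤ t ∧ Function.Injective v ∧ ∀ i : ZMod t, G.Adj (v i) (v (i + 1))

/-- The cycle `v` is extendable: there is a cycle through all vertices of `v` plus exactly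
one new vertex. -/
def CycleExtendable {V : Type*} (G : SimpleGraph V) (t : ℕ) (v : ZMod t → V) : Prop :=
  ∃ x ∉ Set.range v, ∃ w : ZMod (t + 1) → V,
    IsCycleFun G (t + 1) w ∧ Set.range w = insert x (Set.range v)

/-- A closed listing `f 0, …, f (n - 1)` of distinct, consecutively adjacent vertices is a cycle. -/
theorem isCycleFun_of_nat {V : Type*} (G : SimpleGraph V) (n : ℕ) (hn : 3 ≤ n) (f : ℕ → V)
    (hinj : ∀ a < n, ∀ b < n, f a = f b → a = b)
    (hadj : ∀ a, a + 1 < n → G.Adj (f a) (f (a + 1))) (hlast : G.Adj (f (n - 1)) (f 0)) :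
    IsCycleFun G n (fun z => f z.val) := by
  have : NeZero n := ⟨by omega⟩
  have : Fact (1 < n) := ⟨by omega⟩
  refine ⟨hn, fun a b h => ZMod.val_injective n (hinj _ a.val_lt _ b.val_lt h), fun a => ?_⟩
  have ha := a.val_lt
  simp only [ZMod.val_add, ZMod.val_one]
  rcases Nat.lt_or_ge (a.val + 1) n with h | h
  · rw [Nat.mod_eq_of_lt h]
    exact hadj _ h
  · have h' : a.val + 1 = n := by omega
    rw [h', Nat.mod_self, show a.val = n - 1 by omega]
    exact hlast

/-- Two cycle vertices with a common off-cycle neighbour and adjacent successors give an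
extension of the cycle. -/
theorem cycleExtendable_of_adj_succ {V : Type*} (G : SimpleGraph V) (t : ℕ) (v : ZMod t → V)
    (hC : IsCycleFun G t v) (x : V) (hx : x ∉ Set.range v) (i j : ZMod t) (hij : i ≠ j)
    (hxi : G.Adj x (v i)) (hxj : G.Adj x (v j)) (h : G.Adj (v (i + 1)) (v (j + 1))) :
    CycleExtendable G t v := by
  obtain ⟨ht, hv, hadj⟩ := hC
  have : NeZero t := ⟨by omega⟩
  set m := (j - i).val with hm
  have hmt : m < t := ZMod.val_lt _
  have hm0 : 0 < m := by
    rw [Nat.pos_iff_ne_zero, hm, Ne, ZMod.val_eq_zero, sub_eq_zero]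
    exact hij.symm
  have hmj : i + (m : ZMod t) = j := by
    rw [hm, ZMod.natCast_zmod_val]
    ring
  let u : ℕ → V := fun n => v (i + n)
  have hut : u t = v i := by simp [u]
  have hum : u m = v j := by simp [u, hmj]
  have hum1 : u (m + 1) = v (j + 1) := by simp [u, ← hmj, add_assoc]
  have hu1 : u 1 = v (i + 1) := by simp [u]
  have hua : ∀ n, G.Adj (u n) (u (n + 1)) := fun n => by
    simpa [u, add_assoc] using hadj (i + n)
  have hux : ∀ n, u n ≠ x := fun n hn => hx ⟨_, hn⟩
  have huinj : ∀ a b, 1 ≤ a → a ≤ t → 1 ≤ b → b ≤ t → u a = u b → a = b := by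
    intro a b ha hat hb hbt hab
    have hc : ((a : ℕ) : ZMod t) = b := add_left_cancel (hv hab)
    rw [ZMod.natCast_eq_natCast_iff'] at hc
    rcases hat.eq_or_lt with rfl | hat <;> rcases hbt.eq_or_lt with rfl | hbt
    · rfl
    · rw [Nat.mod_self, Nat.mod_eq_of_lt hbt] at hc
      omega
    · rw [Nat.mod_self, Nat.mod_eq_of_lt hat] at hc
      omega
    · rwa [Nat.mod_eq_of_lt hat, Nat.mod_eq_of_lt hbt] at hc
  have husurj : ∀ z, ∃ n, 1 ≤ n ∧ n ≤ t ∧ u n = v z := by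
    intro z
    rcases Nat.eq_zero_or_pos (z - i).val with h0 | h0
    · rw [ZMod.val_eq_zero, sub_eq_zero] at h0
      exact ⟨t, by omega, le_rfl, by rw [hut, h0]⟩
    · exact ⟨(z - i).val, h0, (ZMod.val_lt _).le, by simp [u]⟩
  let g : ℕ → ℕ := fun k => if k ≤ t - m then t + 1 - k else k - (t - m)
  have hg : ∀ k, 1 ≤ k → k ≤ t → 1 ≤ g k ∧ g k ≤ t := fun k h1 h2 => by
    simp only [g]
    split_ifs <;> omega
  have hginj : ∀ a b, a ≤ t → b ≤ t → g a = g b → a = b := fun a b ha hb hab => by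
    simp only [g] at hab
    split_ifs at hab <;> omega
  let f : ℕ → V := fun k => if k = 0 then x else u (g k)
  have hf0 : f 0 = x := rfl
  have hf1 : ∀ k, 1 ≤ k → k ≤ t - m → f k = u (t + 1 - k) := fun k h1 h2 => by
    simp [f, g, h2, Nat.ne_of_gt h1]
  have hf2 : ∀ k, t - m < k → f k = u (k - (t - m)) := fun k h1 => by
    simp only [f, g, if_neg (show k ≠ 0 by omega), if_neg (show ¬ k ≤ t - m by omega)]
  refine ⟨x, hx, fun z => f z.val, isCycleFun_of_nat G (t + 1) (by omega) f ?_ ?_ ?_, ?_⟩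
  · intro a ha b hb hab
    by_cases ha0 : a = 0 <;> by_cases hb0 : b = 0
    · omega
    · simp only [f, if_pos ha0, if_neg hb0] at hab
      exact absurd hab.symm (hux _)
    · simp only [f, if_neg ha0, if_pos hb0] at hab
      exact absurd hab (hux _)
    · simp only [f, if_neg ha0, if_neg hb0] at hab
      have hga := hg a (by omega) (by omega)
      have hgb := hg b (by omega) (by omega)
      have := huinj (g a) (g b) hga.1 hga.2 hgb.1 hgb.2 hab
      exact hginj a b (by omega) (by omega) this
  · intro a ha
    rcases Nat.eq_zero_or_pos a with rfl | ha0
    · rw [hf0, hf1 (0 + 1) (by omega) (by omega), show t + 1 - (0 + 1) = t by omega, hut]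
      exact hxi
    rcases lt_trichotomy a (t - m) with h1 | h1 | h1
    · rw [hf1 a ha0 h1.le, hf1 (a + 1) (by omega) h1,
        show t + 1 - a = (t + 1 - (a + 1)) + 1 by omega]
      exact (hua _).symm
    · rw [hf1 a ha0 h1.le, hf2 (a + 1) (by omega), show t + 1 - a = m + 1 by omega,
        show a + 1 - (t - m) = 1 by omega, hum1, hu1]
      exact h.symm
    · rw [hf2 a h1, hf2 (a + 1) (by omega), show a + 1 - (t - m) = (a - (t - m)) + 1 by omega]
      exact hua _
  · rw [hf0, Nat.add_sub_cancel, hf2 t (by omega), show t - (t - m) = m by omega, hum]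
    exact hxj.symm
  · apply Set.Subset.antisymm
    · rintro _ ⟨z, rfl⟩
      by_cases hz : z.val = 0
      · exact Or.inl (if_pos hz)
      · exact Or.inr ⟨_, (if_neg hz).symm⟩
    · have hmem : ∀ k < t + 1, f k ∈ Set.range fun z : ZMod (t + 1) => f z.val := fun k hk =>
        ⟨(k : ZMod (t + 1)), by simp only [ZMod.val_natCast, Nat.mod_eq_of_lt hk]⟩
      rintro _ (rfl | ⟨z, rfl⟩)
      · exact hmem 0 (by omega)
      · obtain ⟨n, h1, h2, hn⟩ := husurj z
        rw [← hn]
        rcases Nat.lt_or_ge m n with h3 | h3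
        · have := hmem (t + 1 - n) (by omega)
          rwa [hf1 _ (by omega) (by omega), show t + 1 - (t + 1 - n) = n by omega] at this
        · have := hmem (n + (t - m)) (by omega)
          rwa [hf2 _ (by omega), Nat.add_sub_cancel] at this

/-- Reversing the direction of a cycle gives a cycle. -/
theorem IsCycleFun.comp_neg {V : Type*} {G : SimpleGraph V} {t : ℕ} {v : ZMod t → V}
    (hC : IsCycleFun G t v) : IsCycleFun G t (fun z => v (-z)) := by
  refine ⟨hC.1, hC.2.1.comp neg_injective, fun z => ?_⟩
  have := hC.2.2 (-(z + 1))
  rw [show -(z + 1) + 1 = -z by ring] at this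
  exact this.symm


/-- Lemma 3.1(2): if `v_i` and `v_j` are distinct vertices of a non-extendable cycle with a
common off-cycle neighbour `x`, then neither `v_{i+1}v_{j+1}` nor `v_{i-1}v_{j-1}` is an edge. -/
theorem stmt11 {V : Type*} (G : SimpleGraph V) (t : ℕ) (v : ZMod t → V)
    (hC : IsCycleFun G t v) (hne : ¬ CycleExtendable G t v)
    (x : V) (hx : x ∉ Set.range v) (i j : ZMod t) (hij : i ≠ j)
    (hxi : G.Adj x (v i)) (hxj : G.Adj x (v j)) :
    ¬ G.Adj (v (i + 1)) (v (j + 1)) ∧ ¬ G.Adj (v (i - 1)) (v (j - 1)) := by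
  refine ⟨fun h => hne (cycleExtendable_of_adj_succ G t v hC x hx i j hij hxi hxj h),
    fun h => hne ?_⟩
  have hr : Set.range (fun z => v (-z)) = Set.range v := neg_surjective.range_comp v
  have key := cycleExtendable_of_adj_succ G t (fun z => v (-z)) hC.comp_neg x (hr ▸ hx) (-i) (-j)
    (neg_injective.ne hij) (by simpa using hxi) (by simpa using hxj)
    (by simpa only [neg_add', neg_neg, neg_add, ← sub_eq_add_neg] using h)
  rwa [CycleExtendable, hr] at key
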